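/- For |q|<1, the identity Σ_{n∈ℤ} (-1)^n q^{9n²+3n}/(1+q^{9n}) + Σ_{n∈ℤ} (-1)^n q^{9n²+15n+6}/(1+q^{9n+6}) = (2 J_{3,18}/J_{9,18})·Σ_{n∈ℤ} (-1)^n q^{9n²+9n+3}/(1+q^{9n+3}) + J_{3,18}⁶ J₆³ J_{9,18}²/(2 J₁₈⁹) holds. -/

import Mathlib

open scoped BigOperators

noncomputable def poch (a q : ℂ) : ℂ := ∏' n : ℕ, (1 - a * q ^ n)

noncomputable def Jm (m : ℕ) (q : ℂ) : ℂ := poch (q ^ m) (q ^ m)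

noncomputable def Jam (a m : ℕ) (q : ℂ) : ℂ :=
  poch (q ^ a) (q ^ m) * poch (q ^ (m - a)) (q ^ m) * poch (q ^ m) (q ^ m)

noncomputable def Sser (a Q : ℂ) : ℂ :=
  ∑' n : ℕ, (1 / (1 - a * Q ^ n) - 1 / (1 - a⁻¹ * Q ^ (n + 1)))

open Filter Topology

section Pochhammer

variable {a q : ℂ}

lemma summable_norm_mul_pow (a : ℂ) (hq : ‖q‖ < 1) : Summable fun n : ℕ ↦ ‖-(a * q ^ n)‖ := by
  simpa using (summable_geometric_of_lt_one (norm_nonneg q) hq).mul_left ‖a‖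

lemma multipliable_poch (a : ℂ) (hq : ‖q‖ < 1) : Multipliable fun n : ℕ ↦ 1 - a * q ^ n := by
  simpa [sub_eq_add_neg] using multipliable_one_add_of_summable (summable_norm_mul_pow a hq)

lemma poch_eq_mul (a : ℂ) (hq : ‖q‖ < 1) : poch a q = (1 - a) * poch (a * q) q := by
  have e (n : ℕ) : 1 - a * q ^ (n + 1) = 1 - a * q * q ^ n := by ring
  have h : Multipliable fun n : ℕ ↦ 1 - a * q ^ (n + 1) :=
    (multipliable_poch (a * q) hq).congr fun n ↦ (e n).symm
  have h0 := tprod_eq_zero_mul' (f := fun n : ℕ ↦ 1 - a * q ^ n) h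
  rw [tprod_congr e] at h0
  rw [pow_zero, mul_one] at h0
  exact h0

lemma poch_ne_zero (hq : ‖q‖ < 1) (h : ∀ n : ℕ, a * q ^ n ≠ 1) : poch a q ≠ 0 := by
  have := tprod_one_add_ne_zero_of_summable (f := fun n : ℕ ↦ -(a * q ^ n))
    (fun n ↦ by rw [← sub_eq_add_neg, sub_ne_zero]; exact (h n).symm) (summable_norm_mul_pow a hq)
  simpa [poch, sub_eq_add_neg] using this

lemma poch_self_ne_zero (hq : ‖q‖ < 1) : poch q q ≠ 0 := by
  refine poch_ne_zero hq fun n h ↦ ?_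
  have h1 : ‖q‖ ^ (n + 1) = 1 := by rw [← norm_pow, pow_succ', h, norm_one]
  exact (pow_lt_one₀ (norm_nonneg q) hq n.succ_ne_zero).ne h1

lemma differentiable_poch (hq : ‖q‖ < 1) : Differentiable ℂ fun a ↦ poch a q := by
  intro a
  have hu := (summable_geometric_of_lt_one (norm_nonneg q) hq).mul_left (‖a‖ + 1)
  have hprod := Summable.hasProdLocallyUniformlyOn_nat_one_add
    (f := fun (n : ℕ) (z : ℂ) ↦ -(z * q ^ n)) (Metric.isOpen_ball (x := a) (ε := 1)) hu
    (.of_forall fun n z hz ↦ ?_) (fun n ↦ by fun_prop)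
  · have hd := hprod.differentiableOn
      (.of_forall fun _ ↦ by simpa [Finset.prod_fn] using
        DifferentiableOn.finsetProd (fun _ _ ↦ by fun_prop)) Metric.isOpen_ball
    simpa [poch, sub_eq_add_neg] using
      hd.differentiableAt (Metric.isOpen_ball.mem_nhds (Metric.mem_ball_self one_pos))
  · rw [norm_neg, norm_mul, norm_pow]
    gcongr
    have : ‖z - a‖ < 1 := by simpa [dist_eq_norm] using hz
    linarith [norm_le_norm_add_norm_sub' z a]

lemma poch_mul_poch_neg (a : ℂ) (hq : ‖q‖ < 1) :
    poch a q * poch (-a) q = poch (a ^ 2) (q ^ 2) := by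
  rw [poch, poch, ← (multipliable_poch a hq).tprod_mul (multipliable_poch (-a) hq), poch]
  refine tprod_congr fun n ↦ ?_
  ring

lemma norm_pow_lt_one_of {k : ℕ} (hk : k ≠ 0) (hq : ‖q‖ < 1) : ‖q ^ k‖ < 1 := by
  rw [norm_pow]
  exact pow_lt_one₀ (norm_nonneg q) hq hk

lemma poch_eq_prod_residues (a : ℂ) (hq : ‖q‖ < 1) {k : ℕ} (hk : k ≠ 0) :
    poch a q = ∏ i ∈ Finset.range k, poch (a * q ^ i) (q ^ k) := by
  have h1 : Tendsto (fun n ↦ ∏ j ∈ Finset.range (k * n), (1 - a * q ^ j)) atTop (𝓝 (poch a q)) :=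
    (multipliable_poch a hq).hasProd.tendsto_prod_nat.comp
      (tendsto_id.const_mul_atTop' (Nat.pos_of_ne_zero hk))
  have h2 : Tendsto (fun n ↦ ∏ i ∈ Finset.range k, ∏ j ∈ Finset.range n,
      (1 - a * q ^ i * (q ^ k) ^ j)) atTop
      (𝓝 (∏ i ∈ Finset.range k, poch (a * q ^ i) (q ^ k))) :=
    tendsto_finsetProd _ fun i _ ↦
      (multipliable_poch (a * q ^ i) (norm_pow_lt_one_of hk hq)).hasProd.tendsto_prod_nat
  refine tendsto_nhds_unique h1 (h2.congr fun n ↦ ?_)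
  induction n with
  | zero => simp
  | succ n ih =>
    rw [mul_add_one, Finset.prod_range_add, ← ih, ← Finset.prod_mul_distrib]
    refine Finset.prod_congr rfl fun i _ ↦ ?_
    rw [Finset.prod_range_succ]
    ring

end Pochhammer

section Theta

variable {q z : ℂ}

/-- The modified Jacobi theta product `(z; q)_∞ (q / z; q)_∞`. -/
noncomputable def modTheta (z q : ℂ) : ℂ := poch z q * poch (q / z) q

lemma modTheta_div (hq0 : q ≠ 0) (z : ℂ) : modTheta (q / z) q = modTheta z q := by
  rw [modTheta, modTheta, div_div_cancel₀ hq0, mul_comm]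

lemma mul_modTheta_mul (hq0 : q ≠ 0) (hq : ‖q‖ < 1) (hz : z ≠ 0) :
    modTheta (q * z) q = -z⁻¹ * modTheta z q := by
  have h : q / (q * z) = z⁻¹ := by field_simp
  rw [modTheta, modTheta, h, poch_eq_mul z⁻¹ hq, poch_eq_mul z hq, div_eq_inv_mul, mul_comm z q]
  field_simp
  ring

lemma modTheta_inv (hq0 : q ≠ 0) (hq : ‖q‖ < 1) (hz : z ≠ 0) :
    modTheta z⁻¹ q = -z⁻¹ * modTheta z q := by
  rw [← modTheta_div hq0, div_inv_eq_mul, mul_modTheta_mul hq0 hq hz]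

lemma modTheta_one (hq : ‖q‖ < 1) : modTheta 1 q = 0 := by
  simp [modTheta, poch_eq_mul 1 hq]

lemma modTheta_eq_mul (hq : ‖q‖ < 1) (z : ℂ) :
    modTheta z q = (1 - z) * (poch (z * q) q * poch (q / z) q) := by
  rw [modTheta, poch_eq_mul z hq, mul_assoc]

lemma modTheta_ne_zero (hq0 : q ≠ 0) (hq : ‖q‖ < 1) (hz : z ≠ 0) (h : ∀ n : ℤ, z ≠ q ^ n) :
    modTheta z q ≠ 0 := by
  refine mul_ne_zero (poch_ne_zero hq fun n hn ↦ h (-n) ?_)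
    (poch_ne_zero hq fun n hn ↦ h (n + 1) ?_)
  · rw [zpow_neg, zpow_natCast]
    exact eq_inv_of_mul_eq_one_left hn
  · rw [zpow_add₀ hq0, zpow_natCast, zpow_one]
    field_simp at hn
    rw [← hn]
    ring

lemma differentiableAt_modTheta (hq : ‖q‖ < 1) (hz : z ≠ 0) :
    DifferentiableAt ℂ (fun z ↦ modTheta z q) z :=
  (differentiable_poch hq z).mul
    ((differentiable_poch hq _).comp z ((differentiableAt_const q).div differentiableAt_id hz))

lemma analyticAt_modTheta (hq : ‖q‖ < 1) (hz : z ≠ 0) :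
    AnalyticAt ℂ (fun z ↦ modTheta z q) z := by
  rw [Complex.analyticAt_iff_eventually_differentiableAt]
  filter_upwards [isOpen_ne.mem_nhds hz] with w hw using differentiableAt_modTheta hq hw

lemma analyticAt_poch {a : ℂ} (hq : ‖q‖ < 1) : AnalyticAt ℂ (fun a ↦ poch a q) a :=
  (differentiable_poch hq).analyticAt a

end Theta

section LerchSum

variable {s q y : ℂ}

/-- The general term of the level two Appell–Lerch sum. -/
noncomputable def lerchTerm (s q : ℂ) (n : ℤ) (y : ℂ) : ℂ :=
  (-1) ^ n * q ^ (n ^ 2) * y ^ (2 * n) / (1 + s * y * q ^ n)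

/-- The level two Appell–Lerch sum `∑ (-1)^n q^(n^2) y^(2n) / (1 + s y q^n)`. -/
noncomputable def lerchSum (s q y : ℂ) : ℂ := ∑' n : ℤ, lerchTerm s q n y

lemma lerchSum_mul (hq0 : q ≠ 0) (hy : y ≠ 0) (s : ℂ) :
    lerchSum s q (q * y) = -(q⁻¹ * y⁻¹ ^ 2) * lerchSum s q y := by
  rw [lerchSum, lerchSum, ← (Equiv.addRight (1 : ℤ)).tsum_eq (fun n ↦ lerchTerm s q n y),
    ← tsum_mul_left]
  refine tsum_congr fun n ↦ ?_
  have h1 : s * (q * y) * q ^ n = s * y * q ^ (n + 1) := by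
    rw [zpow_add_one₀ hq0]; ring
  have h2 : q ^ ((n + 1) ^ 2) = q ^ (n ^ 2) * q ^ (2 * n) * q := by
    rw [← zpow_add₀ hq0, ← zpow_add_one₀ hq0]; ring_nf
  have h3 : y ^ (2 * (n + 1)) = y ^ (2 * n) * y ^ 2 := by
    rw [mul_add, zpow_add₀ hy]; rfl
  have h4 : (-1 : ℂ) ^ (n + 1) = -(-1) ^ n := by rw [zpow_add_one₀ (by norm_num)]; ring
  simp only [lerchTerm, Equiv.coe_addRight, h1, h2, h3, h4, mul_zpow]
  field_simp

lemma exists_one_add_norm_le (hq0 : 0 < ‖q‖) (hq : ‖q‖ < 1) (w : ℂ) :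
    ∃ C : ℝ, 1 ≤ C ∧ ∀ n : ℤ, 1 + w * q ^ n ≠ 0 →
      1 + ‖w * q ^ n‖ ≤ C * ‖1 + w * q ^ n‖ := by
  rcases eq_or_ne w 0 with rfl | hw
  · exact ⟨1, le_rfl, by simp⟩
  have hw' : 0 < ‖w‖ := norm_pos_iff.2 hw
  have hfin : {n : ℤ | ¬ (‖w * q ^ n‖ ≤ 1 / 2 ∨ 2 ≤ ‖w * q ^ n‖)}.Finite := by
    obtain ⟨N, hN⟩ := exists_pow_lt_of_lt_one (show 0 < 1 / 2 / ‖w‖ by positivity) hq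
    obtain ⟨M, hM⟩ := exists_pow_lt_of_lt_one (show 0 < ‖w‖ / 2 by positivity) hq
    refine (Set.finite_Icc (-M : ℤ) N).subset fun n hn ↦ ?_
    simp only [Set.mem_ofPred_eq, not_or, not_le, norm_mul, norm_zpow] at hn
    obtain ⟨hn1, hn2⟩ := hn
    constructor
    · by_contra! h
      have h1 : ‖q‖ ^ (-(M : ℤ)) ≤ ‖q‖ ^ n := zpow_le_zpow_right_of_le_one₀ hq0 hq.le h.le
      rw [zpow_neg, zpow_natCast] at h1
      have h2 : 2 / ‖w‖ < (‖q‖ ^ M)⁻¹ := by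
        rw [← inv_div]
        exact inv_strictAnti₀ (by positivity) hM
      rw [div_lt_iff₀ hw'] at h2
      nlinarith
    · by_contra! h
      have h1 : ‖q‖ ^ n ≤ ‖q‖ ^ (N : ℤ) := zpow_le_zpow_right_of_le_one₀ hq0 hq.le h.le
      rw [zpow_natCast] at h1
      rw [lt_div_iff₀ hw'] at hN
      nlinarith
  obtain ⟨D, hD⟩ := (hfin.image fun n : ℤ ↦ (1 + ‖w * q ^ n‖) / ‖1 + w * q ^ n‖).bddAbove
  refine ⟨max D 3, le_max_of_le_right (by norm_num), fun n hn ↦ ?_⟩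
  have hn' : 0 < ‖1 + w * q ^ n‖ := norm_pos_iff.2 hn
  by_cases h : ‖w * q ^ n‖ ≤ 1 / 2 ∨ 2 ≤ ‖w * q ^ n‖
  · have h3 : 1 + ‖w * q ^ n‖ ≤ 3 * ‖1 + w * q ^ n‖ := by
      have h1 := norm_sub_norm_le (1 : ℂ) (-(w * q ^ n))
      have h2 := norm_sub_norm_le (w * q ^ n) (-1)
      rw [norm_neg, norm_one, sub_neg_eq_add] at h1
      rw [norm_neg, norm_one, sub_neg_eq_add, add_comm (w * q ^ n)] at h2
      rcases h with h | h <;> linarith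
    exact h3.trans (by gcongr; exact le_max_right _ _)
  · have := hD (Set.mem_image_of_mem _ h)
    rw [div_le_iff₀ hn'] at this
    exact this.trans (by gcongr; exact le_max_left _ _)

lemma norm_zpow_sq_mul_zpow_le (hq0 : 0 < ‖q‖) (hy : y ≠ 0) {B : ℝ} (hB : |Real.log ‖y‖| ≤ B)
    (n : ℤ) : ‖(-1) ^ n * q ^ (n ^ 2) * y ^ (2 * n)‖ ≤
      Real.exp (-Real.pi * (-Real.log ‖q‖ / Real.pi * n ^ 2 - 2 * (B / Real.pi) * |n|)) := by
  have hy' : 0 < ‖y‖ := norm_pos_iff.2 hy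
  have e : ‖(-1) ^ n * q ^ (n ^ 2) * y ^ (2 * n)‖ =
      Real.exp (Real.log ‖q‖ * n ^ 2 + 2 * (Real.log ‖y‖ * n)) := by
    rw [norm_mul, norm_mul, norm_zpow, norm_neg, norm_one, one_zpow, one_mul, norm_zpow, norm_zpow,
      ← Real.rpow_intCast, ← Real.rpow_intCast, Real.rpow_def_of_pos hq0, Real.rpow_def_of_pos hy',
      ← Real.exp_add]
    push_cast
    ring_nf
  rw [e, Real.exp_le_exp]
  have h1 : Real.log ‖y‖ * n ≤ B * |(n : ℝ)| :=
    (le_abs_self _).trans (by rw [abs_mul]; gcongr)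
  have h2 : -Real.pi * (-Real.log ‖q‖ / Real.pi * n ^ 2 - 2 * (B / Real.pi) * |(n : ℝ)|) =
      Real.log ‖q‖ * n ^ 2 + 2 * (B * |(n : ℝ)|) := by
    field_simp [Real.pi_ne_zero]
    ring
  push_cast
  rw [h2]
  linarith

/-- Near `w`, the terms of the Lerch sum without a pole at `w` form a summable family with
analytic sum. -/
lemma lerchSum_regular_part (hq0 : 0 < ‖q‖) (hq : ‖q‖ < 1) (s : ℂ) {w : ℂ} (hw : w ≠ 0) :
    AnalyticAt ℂ (fun y ↦ ∑' n : ℤ, if 1 + s * w * q ^ n = 0 then 0 else lerchTerm s q n y) w ∧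
    ∀ᶠ y in 𝓝 w, Summable fun n : ℤ ↦ if 1 + s * w * q ^ n = 0 then 0 else lerchTerm s q n y := by
  have hq0' : q ≠ 0 := norm_pos_iff.1 hq0
  have hw' : 0 < ‖w‖ := norm_pos_iff.2 hw
  obtain ⟨C, hC1, hC⟩ := exists_one_add_norm_le hq0 hq (s * w)
  have hC0 : 0 < C := by linarith
  set B : ℝ := |Real.log ‖w‖| + Real.log 2 with hB
  set U := Metric.ball w (‖w‖ / (2 * C)) with hU
  have hUo : IsOpen U := Metric.isOpen_ball
  have hUw : U ∈ 𝓝 w := Metric.ball_mem_nhds _ (by positivity)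
  have hlog : -Real.log ‖q‖ / Real.pi > 0 :=
    div_pos (neg_pos.2 (Real.log_neg hq0 hq)) Real.pi_pos
  have hsum := (summable_pow_mul_jacobiTheta₂_term_bound (B / Real.pi) hlog 0).mul_left (2 * C)
  simp only [pow_zero, one_mul] at hsum
  have hdist : ∀ y ∈ U, ‖y - w‖ < ‖w‖ / (2 * C) := fun y hy ↦ by
    simpa [hU, dist_eq_norm] using hy
  have hhalf : ‖w‖ / (2 * C) ≤ ‖w‖ / 2 := by gcongr; linarith
  have hlow : ∀ y ∈ U, ‖w‖ / 2 < ‖y‖ := fun y hy ↦ by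
    linarith [hdist y hy, norm_le_norm_add_norm_sub y w]
  have hup : ∀ y ∈ U, ‖y‖ < 2 * ‖w‖ := fun y hy ↦ by
    linarith [hdist y hy, norm_le_norm_add_norm_sub' y w]
  have hUne : ∀ y ∈ U, y ≠ 0 := fun y hy ↦ norm_pos_iff.1 (by linarith [hlow y hy])
  have hUlog : ∀ y ∈ U, |Real.log ‖y‖| ≤ B := fun y hy ↦ by
    have hy0 : 0 < ‖y‖ := norm_pos_iff.2 (hUne y hy)
    have h1 := Real.log_le_log hy0 (hup y hy).le
    have h2 := Real.log_le_log (by positivity) (hlow y hy).le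
    rw [Real.log_mul two_ne_zero hw'.ne'] at h1
    rw [Real.log_div hw'.ne' two_ne_zero] at h2
    rw [abs_le]
    constructor <;> linarith [neg_abs_le (Real.log ‖w‖), le_abs_self (Real.log ‖w‖)]
  have hden : ∀ y ∈ U, ∀ n : ℤ, 1 + s * w * q ^ n ≠ 0 →
      1 / (2 * C) ≤ ‖1 + s * y * q ^ n‖ := fun y hy n hn ↦ by
    have h1 := hC n hn
    have h2 : ‖1 + s * w * q ^ n‖ - ‖1 + s * y * q ^ n‖ ≤ ‖s * w * q ^ n‖ / (2 * C) := by
      refine (norm_sub_norm_le _ _).trans ?_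
      have : 1 + s * w * q ^ n - (1 + s * y * q ^ n) = s * q ^ n * (w - y) := by ring
      rw [this, norm_mul, norm_mul, norm_mul, norm_mul, norm_sub_rev]
      have h3 := (hdist y hy).le
      calc ‖s‖ * ‖q ^ n‖ * ‖y - w‖ ≤ ‖s‖ * ‖q ^ n‖ * (‖w‖ / (2 * C)) := by gcongr
        _ = _ := by ring
    have h4 : (1 + ‖s * w * q ^ n‖) / C ≤ ‖1 + s * w * q ^ n‖ := by
      rw [div_le_iff₀ hC0]; linarith
    have h5 : 0 ≤ ‖s * w * q ^ n‖ / (2 * C) := by positivity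
    have h6 : (1 + ‖s * w * q ^ n‖) / C = 2 * (1 / (2 * C)) + 2 * (‖s * w * q ^ n‖ / (2 * C)) := by
      field_simp
    have h7 : 0 ≤ 1 / (2 * C) := by positivity
    linarith
  have hbound : ∀ (n : ℤ), ∀ y ∈ U, ‖if 1 + s * w * q ^ n = 0 then 0 else lerchTerm s q n y‖ ≤
      2 * C * Real.exp (-Real.pi * (-Real.log ‖q‖ / Real.pi * n ^ 2
        - 2 * (B / Real.pi) * |n|)) := fun n y hy ↦ by
    split_ifs with h
    · rw [norm_zero]; positivity
    · have h1 := norm_zpow_sq_mul_zpow_le hq0 (hUne y hy) (hUlog y hy) n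
      have h2 := hden y hy n h
      have h3 : 0 < 1 / (2 * C) := by positivity
      rw [lerchTerm, norm_div, div_le_iff₀ (by linarith)]
      refine h1.trans ?_
      have h4 : 1 ≤ 2 * C * ‖1 + s * y * q ^ n‖ := by
        rwa [div_le_iff₀' (by positivity)] at h2
      rw [mul_right_comm (2 * C)]
      exact le_mul_of_one_le_left (Real.exp_nonneg _) h4
  refine ⟨DifferentiableOn.analyticAt (s := U) ?_ hUw, ?_⟩
  · refine Complex.differentiableOn_tsum_of_summable_norm hsum (fun n ↦ ?_) hUo hbound
    split_ifs with h
    · fun_prop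
    · intro y hy
      have hy0 := hUne y hy
      have hne : 1 + s * y * q ^ n ≠ 0 := norm_pos_iff.1
        (lt_of_lt_of_le (by positivity) (hden y hy n h))
      have h1 : DifferentiableAt ℂ (fun y : ℂ ↦ y ^ (2 * n)) y :=
        differentiableAt_zpow.2 (.inl hy0)
      have h2 : DifferentiableAt ℂ (fun y : ℂ ↦ 1 + s * y * q ^ n) y := by fun_prop
      exact ((h1.const_mul _).div h2 hne).differentiableWithinAt
  · filter_upwards [hUw] with y hy
    exact hsum.of_norm_bounded fun n ↦ hbound n y hy

lemma analyticAt_lerchSum (hq0 : 0 < ‖q‖) (hq : ‖q‖ < 1) {w : ℂ} (hw : w ≠ 0)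
    (h : ∀ n : ℤ, 1 + s * w * q ^ n ≠ 0) : AnalyticAt ℂ (lerchSum s q) w := by
  have h1 := (lerchSum_regular_part hq0 hq s hw).1
  simp only [h, if_false] at h1
  exact h1

/-- The Lerch sum has a simple pole at a zero of the denominator of index `0`. -/
lemma exists_lerchSum_eq_pole_add (hq0 : 0 < ‖q‖) (hq : ‖q‖ < 1) {w : ℂ} (hw : w ≠ 0)
    (h : 1 + s * w = 0) :
    ∃ g : ℂ → ℂ, AnalyticAt ℂ g w ∧
      ∀ᶠ y in 𝓝 w, lerchSum s q y = 1 / (1 + s * y) + g y := by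
  obtain ⟨h1, h2⟩ := lerchSum_regular_part hq0 hq s hw
  refine ⟨_, h1, ?_⟩
  have hiff (n : ℤ) : 1 + s * w * q ^ n = 0 ↔ n = 0 := by
    have hsw : s * w = -1 := by linear_combination h
    rw [hsw, neg_one_mul, ← sub_eq_add_neg, sub_eq_zero, eq_comm]
    refine ⟨fun hn ↦ ?_, fun hn ↦ by simp [hn]⟩
    have hn' : ‖q‖ ^ n = 1 := by rw [← norm_zpow, hn, norm_one]
    exact (zpow_eq_one_iff_right₀ hq0.le hq.ne).1 hn'
  simp only [hiff] at h2 ⊢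
  filter_upwards [h2] with y hy
  have hs : Summable fun n ↦ lerchTerm s q n y := by
    refine (summable_congr_cofinite ?_).1 hy
    filter_upwards [(Set.finite_singleton (0 : ℤ)).compl_mem_cofinite] with n hn
    rw [if_neg (by simpa using hn)]
  rw [lerchSum, hs.tsum_eq_add_tsum_ite 0]
  simp [lerchTerm]

end LerchSum

section Liouville

variable {F : ℂ → ℂ} {q w : ℂ}

/-- `F` agrees with an analytic function on a punctured neighbourhood of `w`. -/
def HasAnalyticExtensionAt (F : ℂ → ℂ) (w : ℂ) : Prop :=
  ∃ G : ℂ → ℂ, AnalyticAt ℂ G w ∧ F =ᶠ[𝓝[≠] w] G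

lemma AnalyticAt.hasAnalyticExtensionAt (h : AnalyticAt ℂ F w) : HasAnalyticExtensionAt F w :=
  ⟨F, h, EventuallyEq.rfl⟩

lemma HasAnalyticExtensionAt.comp_of_injective {φ : ℂ → ℂ} (h : HasAnalyticExtensionAt F (φ w))
    (hφ : AnalyticAt ℂ φ w) (hinj : Function.Injective φ) (hF : F ∘ φ =ᶠ[𝓝 w] F) :
    HasAnalyticExtensionAt F w := by
  obtain ⟨G, hG, hFG⟩ := h
  refine ⟨G ∘ φ, hG.comp hφ, ?_⟩
  have ht : Tendsto φ (𝓝[≠] w) (𝓝[≠] (φ w)) :=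
    tendsto_nhdsWithin_iff.2 ⟨hφ.continuousAt.tendsto.mono_left nhdsWithin_le_nhds,
      eventually_mem_nhdsWithin.mono fun z hz ↦ hinj.ne hz⟩
  exact (hF.filter_mono nhdsWithin_le_nhds).symm.trans (ht.eventually hFG)

lemma HasAnalyticExtensionAt.div_of_eq_zero {f g : ℂ → ℂ} (hf : AnalyticAt ℂ f w) (h0 : f w = 0)
    (hg : AnalyticAt ℂ g w) (hgw : g w ≠ 0) :
    HasAnalyticExtensionAt (fun z ↦ f z / ((z - w) * g z)) w := by
  obtain ⟨p, hp⟩ := hf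
  have hd : AnalyticAt ℂ (dslope f w) w := ⟨_, hp.has_fpower_series_dslope_fslope⟩
  refine ⟨fun z ↦ dslope f w z / g z, hd.div hg hgw, ?_⟩
  filter_upwards [self_mem_nhdsWithin] with z hz
  rw [dslope_of_ne f hz, slope_def_field, h0, sub_zero, div_div]

lemma HasAnalyticExtensionAt.add {f g : ℂ → ℂ} (hf : HasAnalyticExtensionAt f w)
    (hg : HasAnalyticExtensionAt g w) : HasAnalyticExtensionAt (fun z ↦ f z + g z) w := by
  obtain ⟨f', hf', hff'⟩ := hf
  obtain ⟨g', hg', hgg'⟩ := hg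
  exact ⟨fun z ↦ f' z + g' z, hf'.add hg', hff'.add hgg'⟩

lemma HasAnalyticExtensionAt.congr {f g : ℂ → ℂ} (hf : HasAnalyticExtensionAt f w)
    (h : g =ᶠ[𝓝[≠] w] f) : HasAnalyticExtensionAt g w :=
  hf.imp fun _ hG ↦ ⟨hG.1, h.trans hG.2⟩

lemma zpow_mul_of_mul_periodic (hq0 : q ≠ 0) (hper : ∀ z, z ≠ 0 → F (q * z) = F z) {z : ℂ}
    (hz : z ≠ 0) (n : ℤ) : F (q ^ n * z) = F z := by
  induction n with
  | zero => simp
  | succ n ih =>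
    rw [zpow_add_one₀ hq0, mul_comm _ q, mul_assoc, hper _ (mul_ne_zero (zpow_ne_zero _ hq0) hz),
      ih]
  | pred n ih =>
    rw [← ih, ← hper _ (mul_ne_zero (zpow_ne_zero (-n - 1) hq0) hz), ← mul_assoc,
      ← zpow_one_add₀ hq0]
    congr 3
    ring

/-- Multiplicative Liouville theorem: a function on `ℂ \ {0}` invariant under `z ↦ q z` all of
whose singularities are removable is constant. -/
lemma eq_of_mul_periodic_of_hasAnalyticExtensionAt (hq0 : 0 < ‖q‖) (hq : ‖q‖ < 1)
    (hper : ∀ z, z ≠ 0 → F (q * z) = F z) (hext : ∀ w, w ≠ 0 → HasAnalyticExtensionAt F w)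
    {a b : ℂ} (ha0 : a ≠ 0) (hb0 : b ≠ 0) (ha : ContinuousAt F a) (hb : ContinuousAt F b) :
    F a = F b := by
  have hq0' : q ≠ 0 := norm_pos_iff.1 hq0
  choose! G hG hFG using hext
  have hlim (w : ℂ) (hw : w ≠ 0) : Tendsto F (𝓝[≠] w) (𝓝 (G w w)) :=
    ((hG w hw).continuousAt.tendsto.mono_left nhdsWithin_le_nhds).congr' (hFG w hw).symm
  have hcont (w : ℂ) (hw : w ≠ 0) (hc : ContinuousAt F w) : G w w = F w :=
    tendsto_nhds_unique (hlim w hw) (hc.tendsto.mono_left nhdsWithin_le_nhds)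
  set H : ℂ → ℂ := fun w ↦ G w w with hH
  have hHG (w : ℂ) (hw : w ≠ 0) : H =ᶠ[𝓝 w] G w := by
    have h1 : ∀ᶠ z in 𝓝[≠] w, ∀ᶠ y in 𝓝 z, F y = G w y := by
      have := eventually_eventually_nhdsWithin.2 (hFG w hw)
      filter_upwards [this, self_mem_nhdsWithin] with z hz hzw
      rwa [nhdsWithin_eq_nhds.2 (isOpen_compl_singleton.mem_nhds hzw)] at hz
    have h2 : ∀ᶠ z in 𝓝[≠] w, H z = G w z := by
      filter_upwards [h1, ((hG w hw).eventually_analyticAt).filter_mono nhdsWithin_le_nhds,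
        (isOpen_ne.eventually_mem hw).filter_mono nhdsWithin_le_nhds]
        with z hz hza hz0
      have hcz : ContinuousAt F z := hza.continuousAt.congr (EventuallyEq.symm hz)
      rw [hH]
      exact (hcont z hz0 hcz).trans hz.self_of_nhds
    rw [eventually_nhdsWithin_iff] at h2
    filter_upwards [h2] with z hz
    rcases eq_or_ne z w with rfl | hzw
    · rfl
    · exact hz hzw
  have hHd (w : ℂ) (hw : w ≠ 0) : DifferentiableAt ℂ H w :=
    (hG w hw).differentiableAt.congr_of_eventuallyEq (hHG w hw)
  have hHper (z : ℂ) (hz : z ≠ 0) : H (q * z) = H z := by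
    have ht : Tendsto (fun y ↦ q * y) (𝓝[≠] z) (𝓝[≠] (q * z)) :=
      tendsto_nhdsWithin_iff.2 ⟨(continuous_const_mul q).continuousAt.tendsto.mono_left
        nhdsWithin_le_nhds, eventually_mem_nhdsWithin.mono fun y hy ↦
          (mul_right_injective₀ hq0').ne hy⟩
    refine tendsto_nhds_unique ((hlim _ (mul_ne_zero hq0' hz)).comp ht) ((hlim z hz).congr' ?_)
    filter_upwards [(isOpen_ne.eventually_mem hz).filter_mono nhdsWithin_le_nhds]
      with y hy
    exact (hper y hy).symm
  set K : Set ℂ := Metric.closedBall 0 1 \ Metric.ball 0 ‖q‖ with hK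
  have hKc : IsCompact K := (isCompact_closedBall 0 1).diff Metric.isOpen_ball
  have hKb : Bornology.IsBounded (H '' K) := by
    refine (hKc.image_of_continuousOn fun z hz ↦ ?_).isBounded
    refine (hHd z fun h ↦ hz.2 ?_).continuousAt.continuousWithinAt
    simpa [h] using hq0
  have hbd : Bornology.IsBounded (Set.range fun z ↦ H (Complex.exp z)) := by
    refine hKb.subset ?_
    rintro _ ⟨z, rfl⟩
    have hz : 0 < ‖Complex.exp z‖ := norm_pos_iff.2 (Complex.exp_ne_zero z)
    obtain ⟨n, hn1, hn2⟩ := exists_mem_Ioc_zpow hz ((one_lt_inv₀ hq0).2 hq)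
    refine ⟨q ^ (n + 1) * Complex.exp z, ?_,
      zpow_mul_of_mul_periodic hq0' hHper (Complex.exp_ne_zero z) _⟩
    have hn : 0 < ‖q‖ ^ (n + 1) := zpow_pos hq0 _
    simp only [hK, Set.mem_sdiff, mem_closedBall_zero_iff, mem_ball_zero_iff, norm_mul, norm_zpow,
      not_lt]
    rw [inv_zpow] at hn1 hn2
    constructor
    · calc ‖q‖ ^ (n + 1) * ‖Complex.exp z‖ ≤ ‖q‖ ^ (n + 1) * (‖q‖ ^ (n + 1))⁻¹ := by gcongr
        _ = 1 := mul_inv_cancel₀ hn.ne'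
    · calc ‖q‖ = ‖q‖ ^ (n + 1) * (‖q‖ ^ n)⁻¹ := by
            rw [zpow_add_one₀ hq0.ne']; field_simp
        _ ≤ _ := by gcongr
  have hexp : Differentiable ℂ fun z ↦ H (Complex.exp z) := fun z ↦
    (hHd _ (Complex.exp_ne_zero z)).comp z Complex.differentiable_exp.differentiableAt
  have := hexp.apply_eq_apply_of_bounded hbd (Complex.log a) (Complex.log b)
  rw [Complex.exp_log ha0, Complex.exp_log hb0] at this
  rw [← hcont a ha0 ha, ← hcont b hb0 hb]
  exact this

end Liouville

section LerchIdentity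

variable {x q w y : ℂ}

/-- The sum of the Lerch sum with parameter `x⁻¹` and its image under `y ↦ y⁻¹`. -/
noncomputable def lerchEven (x q y : ℂ) : ℂ := lerchSum x⁻¹ q y + lerchSum x⁻¹ q y⁻¹

/-- The theta function `(q y², q / y²; q²)_∞`. -/
noncomputable def evenTheta (q y : ℂ) : ℂ := modTheta (y ^ 2 * q) (q ^ 2)

/-- The product of the theta functions vanishing at the poles of `lerchEven x q`. -/
noncomputable def poleTheta (x q y : ℂ) : ℂ := modTheta (-(x⁻¹ * y)) q * modTheta (-(x * y)) q

/-- The constant matching the residues of `lerchEven x q / evenTheta q` at its poles. -/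
noncomputable def residueConst (x q : ℂ) : ℂ :=
  poch q q ^ 2 * modTheta (x ^ 2) q / (evenTheta q x * modTheta (-x) q ^ 2)

/-- The quotient `lerchEven x q / evenTheta q` minus a theta quotient with the same poles. -/
noncomputable def lerchRemainder (x q y : ℂ) : ℂ :=
  lerchEven x q y / evenTheta q y - residueConst x q * modTheta y q ^ 2 / poleTheta x q y

lemma lerchEven_inv (x q y : ℂ) : lerchEven x q y⁻¹ = lerchEven x q y := by
  rw [lerchEven, lerchEven, inv_inv, add_comm]

lemma lerchEven_mul (hq0 : q ≠ 0) (hy : y ≠ 0) :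
    lerchEven x q (q * y) = -(q⁻¹ * y⁻¹ ^ 2) * lerchEven x q y := by
  have hqy : (q * y)⁻¹ ≠ 0 := inv_ne_zero (mul_ne_zero hq0 hy)
  have h := lerchSum_mul hq0 hqy x⁻¹
  have e : q * (q * y)⁻¹ = y⁻¹ := by field_simp
  rw [e, inv_inv] at h
  rw [lerchEven, lerchEven, lerchSum_mul hq0 hy, h]
  field_simp
  ring

lemma lerchEven_eq_zero (hq0 : q ≠ 0) (hw : w ^ 2 * q = 1) : lerchEven x q w = 0 := by
  have hw0 : w ≠ 0 := by rintro rfl; simp at hw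
  have e : q * w = w⁻¹ := eq_inv_of_mul_eq_one_left (by rw [← hw]; ring)
  have e2 : q⁻¹ * w⁻¹ ^ 2 = 1 := by rw [inv_pow, ← mul_inv, mul_comm q, hw, inv_one]
  have h := lerchEven_mul (x := x) hq0 hw0
  rw [e, lerchEven_inv, e2] at h
  linear_combination h / 2

lemma evenTheta_inv (hq0 : q ≠ 0) (hy : y ≠ 0) : evenTheta q y⁻¹ = evenTheta q y := by
  rw [evenTheta, evenTheta, ← modTheta_div (pow_ne_zero 2 hq0)]
  congr 1
  field_simp

lemma evenTheta_mul (hq0 : q ≠ 0) (hq : ‖q‖ < 1) (hy : y ≠ 0) :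
    evenTheta q (q * y) = -(q⁻¹ * y⁻¹ ^ 2) * evenTheta q y := by
  have e : (q * y) ^ 2 * q = q ^ 2 * (y ^ 2 * q) := by ring
  rw [evenTheta, e, mul_modTheta_mul (pow_ne_zero 2 hq0) (norm_pow_lt_one_of two_ne_zero hq)
    (by positivity), evenTheta]
  congr 1
  field_simp

lemma evenTheta_neg (q y : ℂ) : evenTheta q (-y) = evenTheta q y := by
  rw [evenTheta, evenTheta, neg_sq]

lemma poleTheta_mul (hx : x ≠ 0) (hq0 : q ≠ 0) (hq : ‖q‖ < 1) (hy : y ≠ 0) :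
    poleTheta x q (q * y) = y⁻¹ ^ 2 * poleTheta x q y := by
  have e1 : -(x⁻¹ * (q * y)) = q * -(x⁻¹ * y) := by ring
  have e2 : -(x * (q * y)) = q * -(x * y) := by ring
  have h1 : -(x⁻¹ * y) ≠ 0 := by simp [hx, hy]
  have h2 : -(x * y) ≠ 0 := by simp [hx, hy]
  rw [poleTheta, e1, e2, mul_modTheta_mul hq0 hq h1, mul_modTheta_mul hq0 hq h2, poleTheta]
  field_simp

lemma poleTheta_inv (hx : x ≠ 0) (hq0 : q ≠ 0) (hq : ‖q‖ < 1) (hy : y ≠ 0) :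
    poleTheta x q y⁻¹ = y⁻¹ ^ 2 * poleTheta x q y := by
  have e1 : -(x⁻¹ * y⁻¹) = (-(x * y))⁻¹ := by field_simp
  have e2 : -(x * y⁻¹) = (-(x⁻¹ * y))⁻¹ := by field_simp
  have h1 : -(x⁻¹ * y) ≠ 0 := by simp [hx, hy]
  have h2 : -(x * y) ≠ 0 := by simp [hx, hy]
  rw [poleTheta, e1, e2, modTheta_inv hq0 hq h1, modTheta_inv hq0 hq h2, poleTheta]
  field_simp

lemma lerchRemainder_mul (hx : x ≠ 0) (hq0 : q ≠ 0) (hq : ‖q‖ < 1) (hy : y ≠ 0) :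
    lerchRemainder x q (q * y) = lerchRemainder x q y := by
  have h1 : -(q⁻¹ * y⁻¹ ^ 2) ≠ 0 := by simp [hq0, hy]
  have h2 : y⁻¹ ^ 2 ≠ 0 := by simp [hy]
  rw [lerchRemainder, lerchEven_mul hq0 hy, evenTheta_mul hq0 hq hy, poleTheta_mul hx hq0 hq hy,
    mul_modTheta_mul hq0 hq hy, mul_div_mul_left _ _ h1, mul_pow, neg_sq, mul_left_comm,
    mul_div_mul_left _ _ h2, lerchRemainder]

lemma lerchRemainder_inv (hx : x ≠ 0) (hq0 : q ≠ 0) (hq : ‖q‖ < 1) (hy : y ≠ 0) :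
    lerchRemainder x q y⁻¹ = lerchRemainder x q y := by
  have h2 : y⁻¹ ^ 2 ≠ 0 := by simp [hy]
  rw [lerchRemainder, lerchEven_inv, evenTheta_inv hq0 hy, poleTheta_inv hx hq0 hq hy,
    modTheta_inv hq0 hq hy, mul_pow, neg_sq, mul_left_comm, mul_div_mul_left _ _ h2, lerchRemainder]

lemma analyticAt_evenTheta (hq0 : q ≠ 0) (hq : ‖q‖ < 1) (hw : w ≠ 0) :
    AnalyticAt ℂ (evenTheta q) w :=
  (analyticAt_modTheta (norm_pow_lt_one_of two_ne_zero hq) (by positivity)).comp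
    (f := fun y ↦ y ^ 2 * q) (by fun_prop)

lemma analyticAt_poleTheta (hx : x ≠ 0) (hq : ‖q‖ < 1) (hw : w ≠ 0) :
    AnalyticAt ℂ (poleTheta x q) w :=
  ((analyticAt_modTheta hq (by simp [hx, hw])).comp (f := fun y ↦ -(x⁻¹ * y)) (by fun_prop)).mul
    ((analyticAt_modTheta hq (by simp [hx, hw])).comp (f := fun y ↦ -(x * y)) (by fun_prop))

lemma evenTheta_ne_zero (hq0 : q ≠ 0) (hq : ‖q‖ < 1) (hw : w ≠ 0)
    (h : ∀ n : ℤ, w ^ 2 * q ≠ (q ^ 2) ^ n) : evenTheta q w ≠ 0 :=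
  modTheta_ne_zero (pow_ne_zero 2 hq0) (norm_pow_lt_one_of two_ne_zero hq) (by positivity) h

lemma poleTheta_ne_zero (hx : x ≠ 0) (hq0 : q ≠ 0) (hq : ‖q‖ < 1) (hw : w ≠ 0)
    (h1 : ∀ n : ℤ, w ≠ -x * q ^ n) (h2 : ∀ n : ℤ, w ≠ -x⁻¹ * q ^ n) : poleTheta x q w ≠ 0 := by
  refine mul_ne_zero (modTheta_ne_zero hq0 hq (by simp [hx, hw]) fun n hn ↦ h1 n ?_)
    (modTheta_ne_zero hq0 hq (by simp [hx, hw]) fun n hn ↦ h2 n ?_)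
  · rw [← hn]; field_simp
  · rw [← hn]; field_simp

lemma analyticAt_lerchSum_inv_param (hx : x ≠ 0) (hq0 : 0 < ‖q‖) (hq : ‖q‖ < 1) (hw : w ≠ 0)
    (h : ∀ n : ℤ, w ≠ -x * q ^ n) : AnalyticAt ℂ (lerchSum x⁻¹ q) w := by
  have hq0' : q ≠ 0 := norm_pos_iff.1 hq0
  refine analyticAt_lerchSum hq0 hq hw fun n hn ↦ h (-n) ?_
  have hqn := zpow_ne_zero n hq0'
  rw [zpow_neg]
  field_simp at hn ⊢
  linear_combination hn

lemma analyticAt_lerchSum_inv (hx : x ≠ 0) (hq0 : 0 < ‖q‖) (hq : ‖q‖ < 1) (hw : w ≠ 0)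
    (h : ∀ n : ℤ, w ≠ -x⁻¹ * q ^ n) : AnalyticAt ℂ (fun y ↦ lerchSum x⁻¹ q y⁻¹) w := by
  refine (analyticAt_lerchSum_inv_param hx hq0 hq (inv_ne_zero hw) fun n hn ↦ h (-n) ?_).comp
    (f := fun y : ℂ ↦ y⁻¹) (analyticAt_inv hw)
  rw [← inv_inv w, hn, mul_inv, inv_neg, zpow_neg]

lemma analyticAt_lerchEven (hx : x ≠ 0) (hq0 : 0 < ‖q‖) (hq : ‖q‖ < 1) (hw : w ≠ 0)
    (h1 : ∀ n : ℤ, w ≠ -x * q ^ n) (h2 : ∀ n : ℤ, w ≠ -x⁻¹ * q ^ n) :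
    AnalyticAt ℂ (lerchEven x q) w :=
  (analyticAt_lerchSum_inv_param hx hq0 hq hw h1).add (analyticAt_lerchSum_inv hx hq0 hq hw h2)

lemma analyticAt_residue_div_poleTheta (hx : x ≠ 0) (hq0 : q ≠ 0) (hq : ‖q‖ < 1) (hw : w ≠ 0)
    (h1 : ∀ n : ℤ, w ≠ -x * q ^ n) (h2 : ∀ n : ℤ, w ≠ -x⁻¹ * q ^ n) :
    AnalyticAt ℂ (fun y ↦ residueConst x q * modTheta y q ^ 2 / poleTheta x q y) w :=
  (analyticAt_const.mul ((analyticAt_modTheta hq hw).pow 2)).div (analyticAt_poleTheta hx hq hw)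
    (poleTheta_ne_zero hx hq0 hq hw h1 h2)

lemma analyticAt_lerchRemainder (hx : x ≠ 0) (hq0 : 0 < ‖q‖) (hq : ‖q‖ < 1) (hw : w ≠ 0)
    (h1 : ∀ n : ℤ, w ≠ -x * q ^ n) (h2 : ∀ n : ℤ, w ≠ -x⁻¹ * q ^ n)
    (h3 : ∀ n : ℤ, w ^ 2 * q ≠ (q ^ 2) ^ n) : AnalyticAt ℂ (lerchRemainder x q) w :=
  have hq0' : q ≠ 0 := norm_pos_iff.1 hq0
  ((analyticAt_lerchEven hx hq0 hq hw h1 h2).div (analyticAt_evenTheta hq0' hq hw)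
    (evenTheta_ne_zero hq0' hq hw h3)).sub (analyticAt_residue_div_poleTheta hx hq0' hq hw h1 h2)

/-- The factor of `modTheta z q` complementary to `1 - z`. -/
noncomputable def thetaCofactor (z q : ℂ) : ℂ := poch (z * q) q * poch (q / z) q

lemma thetaCofactor_one (q : ℂ) : thetaCofactor 1 q = poch q q ^ 2 := by
  rw [thetaCofactor, one_mul, div_one, sq]

lemma analyticAt_thetaCofactor {z : ℂ} (hq : ‖q‖ < 1) (hz : z ≠ 0) :
    AnalyticAt ℂ (fun z ↦ thetaCofactor z q) z :=
  ((analyticAt_poch hq).comp (f := fun z ↦ z * q) (by fun_prop)).mul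
    ((analyticAt_poch hq).comp (f := fun z ↦ q / z) (analyticAt_const.div analyticAt_id hz))

lemma hasAnalyticExtensionAt_lerchRemainder_of_sq_mul (hx : x ≠ 0) (hq0 : 0 < ‖q‖) (hq : ‖q‖ < 1)
    (hw : w ^ 2 * q = 1) (h1 : ∀ n : ℤ, w ≠ -x * q ^ n) (h2 : ∀ n : ℤ, w ≠ -x⁻¹ * q ^ n) :
    HasAnalyticExtensionAt (lerchRemainder x q) w := by
  have hq0' : q ≠ 0 := norm_pos_iff.1 hq0
  have hw0 : w ≠ 0 := by rintro rfl; simp at hw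
  have hq2 := norm_pow_lt_one_of two_ne_zero hq
  have hχ : AnalyticAt ℂ (fun y ↦ thetaCofactor (y ^ 2 * q) (q ^ 2)) w :=
    (analyticAt_thetaCofactor hq2 (by positivity)).comp (f := fun y ↦ y ^ 2 * q) (by fun_prop)
  have hmain : HasAnalyticExtensionAt (fun y ↦ lerchEven x q y /
      ((y - w) * (-(q * (y + w)) * thetaCofactor (y ^ 2 * q) (q ^ 2)))) w := by
    refine .div_of_eq_zero (analyticAt_lerchEven hx hq0 hq hw0 h1 h2) (lerchEven_eq_zero hq0' hw)
      (.mul (by fun_prop) hχ) ?_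
    rw [hw, thetaCofactor_one, ← two_mul]
    have := poch_self_ne_zero hq2
    simp [hq0', hw0, this]
  refine (hmain.add
    (analyticAt_residue_div_poleTheta hx hq0' hq hw0 h1 h2).neg.hasAnalyticExtensionAt).congr
    (.of_eq (funext fun y ↦ ?_))
  rw [lerchRemainder, sub_eq_add_neg, evenTheta, modTheta_eq_mul hq2]
  congr 2
  rw [thetaCofactor]
  linear_combination
    -(poch (y ^ 2 * q * q ^ 2) (q ^ 2) * poch (q ^ 2 / (y ^ 2 * q)) (q ^ 2)) * hw

lemma hasAnalyticExtensionAt_lerchRemainder_neg (hx : x ≠ 0) (hq0 : 0 < ‖q‖) (hq : ‖q‖ < 1)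
    (h1 : ∀ n : ℤ, x ^ 2 ≠ q ^ n) (h2 : ∀ n : ℤ, -x ≠ q ^ n) :
    HasAnalyticExtensionAt (lerchRemainder x q) (-x) := by
  have hq0' : q ≠ 0 := norm_pos_iff.1 hq0
  have hx' : -x ≠ 0 := neg_ne_zero.2 hx
  obtain ⟨g, hg, hgE⟩ := exists_lerchSum_eq_pole_add (s := x⁻¹) hq0 hq hx' (by field_simp; ring)
  have hinv : AnalyticAt ℂ (fun y ↦ lerchSum x⁻¹ q y⁻¹) (-x) :=
    analyticAt_lerchSum_inv hx hq0 hq hx' fun n hn ↦ h1 n (by field_simp at hn; exact neg_inj.1 hn)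
  have hΘ := analyticAt_evenTheta hq0' hq hx'
  have hΘ0 : evenTheta q (-x) ≠ 0 := evenTheta_ne_zero hq0' hq hx' fun n hn ↦ h1 (2 * n - 1) (by
    rw [zpow_sub_one₀ hq0', zpow_mul, eq_mul_inv_iff_mul_eq₀ hq0', ← neg_sq x]
    exact hn)
  set ψ : ℂ → ℂ := fun y ↦ thetaCofactor (-(x⁻¹ * y)) q with hψ
  set ϑ : ℂ → ℂ := fun y ↦ modTheta (-(x * y)) q with hϑ
  have hψa : AnalyticAt ℂ ψ (-x) :=
    (analyticAt_thetaCofactor hq (by simp [hx])).comp (f := fun y ↦ -(x⁻¹ * y)) (by fun_prop)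
  have hϑa : AnalyticAt ℂ ϑ (-x) :=
    (analyticAt_modTheta hq (by simp [hx])).comp (f := fun y ↦ -(x * y)) (by fun_prop)
  have hψx : ψ (-x) = poch q q ^ 2 := by
    rw [hψ, ← thetaCofactor_one]
    simp [hx]
  have hψ0 : ψ (-x) ≠ 0 := hψx ▸ pow_ne_zero 2 (poch_self_ne_zero hq)
  have hϑx : ϑ (-x) = modTheta (x ^ 2) q := by
    rw [hϑ]
    ring_nf
  have hϑ0 : ϑ (-x) ≠ 0 := hϑx ▸ modTheta_ne_zero hq0' hq (by positivity) h1
  have hθ0 : modTheta (-x) q ≠ 0 := modTheta_ne_zero hq0' hq hx' h2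
  have hmain : HasAnalyticExtensionAt (fun y ↦
      (ψ y * ϑ y - residueConst x q * modTheta y q ^ 2 * evenTheta q y) /
        ((y - -x) * (x⁻¹ * (ψ y * ϑ y * evenTheta q y)))) (-x) := by
    refine .div_of_eq_zero ((hψa.mul hϑa).sub ((analyticAt_const.mul
      ((analyticAt_modTheta hq hx').pow 2)).mul hΘ)) ?_
      (analyticAt_const.mul ((hψa.mul hϑa).mul hΘ)) (by simp [hx, hψ0, hϑ0, hΘ0])
    rw [hψx, hϑx, residueConst, ← evenTheta_neg]
    field_simp
    ring
  refine (hmain.add ((hg.add hinv).div hΘ hΘ0).hasAnalyticExtensionAt).congr ?_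
  filter_upwards [self_mem_nhdsWithin, hgE.filter_mono nhdsWithin_le_nhds,
    (hψa.continuousAt.eventually_ne hψ0).filter_mono nhdsWithin_le_nhds,
    (hϑa.continuousAt.eventually_ne hϑ0).filter_mono nhdsWithin_le_nhds,
    (hΘ.continuousAt.eventually_ne hΘ0).filter_mono nhdsWithin_le_nhds] with y hy hyE hyψ hyϑ hyΘ
  have hyx : y + x ≠ 0 := fun h ↦ hy (eq_neg_of_add_eq_zero_left h)
  have hpole : poleTheta x q y = x⁻¹ * (y + x) * (ψ y * ϑ y) := by
    rw [poleTheta, modTheta_eq_mul hq]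
    simp only [hψ, hϑ, thetaCofactor]
    field_simp
    ring
  have hden : 1 + x⁻¹ * y = x⁻¹ * (y + x) := by field_simp; ring
  simp only [Pi.div_apply, Pi.add_apply]
  rw [lerchRemainder, hpole, lerchEven, hyE, hden, sub_neg_eq_add]
  field_simp
  ring

lemma lerchRemainder_eq (hq0 : 0 < ‖q‖) (hq : ‖q‖ < 1) (hx : x ≠ 0)
    (h : ∀ n : ℤ, ‖x‖ ^ 2 ≠ ‖q‖ ^ n) : lerchRemainder x q x = lerchRemainder x q 1 := by
  have hq0' : q ≠ 0 := norm_pos_iff.1 hq0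
  have hodd (n : ℤ) : ‖q‖ ≠ ‖q‖ ^ (2 * n) := fun hn ↦ by
    have := zpow_right_injective₀ hq0 hq.ne ((zpow_one ‖q‖).trans hn)
    omega
  have hx1 (n : ℤ) : ‖x‖ ≠ ‖q‖ ^ n := fun hn ↦ h (n * 2) (by
    rw [hn, zpow_mul]; rfl)
  have hx2 (n : ℤ) : x ^ 2 ≠ q ^ n := fun hn ↦ h n (by rw [← norm_pow, hn, norm_zpow])
  have hxn (n : ℤ) : -x ≠ q ^ n := fun hn ↦ hx1 n (by rw [← norm_neg, hn, norm_zpow])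
  have hsq (w : ℂ) (hw : ‖w‖ = ‖x‖) (n : ℤ) : w ^ 2 * q ≠ (q ^ 2) ^ n := fun hn ↦ h (2 * n - 1) (by
    rw [zpow_sub_one₀ hq0.ne', zpow_mul, eq_mul_inv_iff_mul_eq₀ hq0.ne', ← hw]
    simpa using congrArg norm hn)
  have hper (z : ℂ) (hz : z ≠ 0) : lerchRemainder x q (q * z) = lerchRemainder x q z :=
    lerchRemainder_mul hx hq0' hq hz
  have htrans (w : ℂ) (hw : w ≠ 0) (n : ℤ)
      (hext : HasAnalyticExtensionAt (lerchRemainder x q) (q ^ n * w)) :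
      HasAnalyticExtensionAt (lerchRemainder x q) w := by
    refine hext.comp_of_injective (φ := fun z ↦ q ^ n * z) (by fun_prop)
      (mul_right_injective₀ (zpow_ne_zero n hq0')) ?_
    filter_upwards [isOpen_ne.mem_nhds hw] with z hz
    exact zpow_mul_of_mul_periodic hq0' hper hz n
  have hneg (n : ℤ) : HasAnalyticExtensionAt (lerchRemainder x q) (-x * q ^ n) := by
    refine htrans _ (mul_ne_zero (neg_ne_zero.2 hx) (zpow_ne_zero n hq0')) (-n) ?_
    have e : q ^ (-n) * (-x * q ^ n) = -x := by
      rw [zpow_neg]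
      field_simp
    rw [e]
    exact hasAnalyticExtensionAt_lerchRemainder_neg hx hq0 hq hx2 hxn
  refine eq_of_mul_periodic_of_hasAnalyticExtensionAt hq0 hq hper (fun w hw ↦ ?_) hx one_ne_zero
    (analyticAt_lerchRemainder hx hq0 hq hx (fun n hn ↦ ?_) (fun n hn ↦ ?_)
      (hsq x rfl)).continuousAt
    (analyticAt_lerchRemainder hx hq0 hq one_ne_zero (fun n hn ↦ ?_) (fun n hn ↦ ?_)
      (fun n hn ↦ ?_)).continuousAt
  · by_cases h1 : ∃ n : ℤ, w = -x * q ^ n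
    · obtain ⟨n, rfl⟩ := h1
      exact hneg n
    by_cases h2 : ∃ n : ℤ, w = -x⁻¹ * q ^ n
    · obtain ⟨n, hn⟩ := h2
      have e : w⁻¹ = -x * q ^ (-n) := by rw [hn, mul_inv, inv_neg, inv_inv, zpow_neg]
      refine HasAnalyticExtensionAt.comp_of_injective (φ := fun z ↦ z⁻¹) (e ▸ hneg (-n))
        (analyticAt_inv hw) inv_injective ?_
      filter_upwards [isOpen_ne.mem_nhds hw] with z hz
      exact lerchRemainder_inv hx hq0' hq hz
    by_cases h3 : ∃ n : ℤ, w ^ 2 * q = (q ^ 2) ^ n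
    · obtain ⟨n, hn⟩ := h3
      push Not at h1 h2
      refine htrans w hw (-n) (hasAnalyticExtensionAt_lerchRemainder_of_sq_mul hx hq0 hq ?_
        (fun m hm ↦ h1 (m + n) ?_) (fun m hm ↦ h2 (m + n) ?_))
      · rw [mul_pow, mul_assoc, hn, ← zpow_natCast, ← zpow_mul, ← zpow_natCast, ← zpow_mul,
          ← zpow_add₀ hq0']
        simp [mul_comm]
      · rw [zpow_add₀ hq0', ← mul_assoc, ← hm, zpow_neg]
        field_simp
      · rw [zpow_add₀ hq0', ← mul_assoc, ← hm, zpow_neg]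
        field_simp
    push Not at h1 h2 h3
    exact (analyticAt_lerchRemainder hx hq0 hq hw h1 h2 h3).hasAnalyticExtensionAt
  · have hn' : q ^ n = -1 := mul_left_cancel₀ hx (by linear_combination hn)
    have : ‖q‖ ^ n = 1 := by rw [← norm_zpow, hn', norm_neg, norm_one]
    rw [(zpow_eq_one_iff_right₀ hq0.le hq.ne).1 this, zpow_zero] at hn'
    norm_num at hn'
  · refine h n ?_
    rw [← norm_zpow, ← norm_pow, ← norm_neg (q ^ n)]
    congr 1
    rw [sq]
    nth_rw 1 [hn]
    field_simp
  · refine hx1 (-n) ?_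
    have h1 := congrArg norm hn
    rw [norm_mul, norm_neg, norm_zpow, norm_one] at h1
    rw [zpow_neg]
    exact eq_inv_of_mul_eq_one_left h1.symm
  · refine hx1 n ?_
    have h1 := congrArg norm hn
    rw [norm_mul, norm_neg, norm_inv, norm_zpow, norm_one] at h1
    have hx0 : ‖x‖ ≠ 0 := norm_ne_zero_iff.2 hx
    field_simp at h1
    exact h1
  · have := congrArg norm hn
    rw [one_pow, one_mul, norm_zpow, norm_pow, ← zpow_natCast, ← zpow_mul] at this
    exact hodd n this

end LerchIdentity

section CubicBase

variable {x q : ℂ}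

lemma lerchSum_zpow (hq0 : q ≠ 0) (k : ℤ) :
    lerchSum (q ^ 3)⁻¹ (q ^ 9) (q ^ k) =
      ∑' n : ℤ, (-1) ^ n * q ^ (9 * n ^ 2 + (9 - 2 * k) * n + (3 - k)) /
        (1 + q ^ (9 * n + (3 - k))) := by
  rw [lerchSum, ← (Equiv.neg ℤ).tsum_eq fun n ↦ lerchTerm _ _ n _]
  refine tsum_congr fun n ↦ ?_
  have h1 : (-1 : ℂ) ^ (-n) = (-1) ^ n := by rw [zpow_neg, ← inv_zpow, inv_neg_one]
  have h2 : (q ^ 9) ^ ((-n) ^ 2) = q ^ (9 * n ^ 2) := by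
    rw [← zpow_natCast, ← zpow_mul, neg_sq]; rfl
  have h3 : (q ^ k) ^ (2 * -n) = q ^ (-(2 * k * n)) := by
    rw [← zpow_mul]; ring_nf
  have h4 : (q ^ 3)⁻¹ * q ^ k * (q ^ 9) ^ (-n) = (q ^ (9 * n + (3 - k)))⁻¹ := by
    rw [← zpow_neg, ← zpow_natCast, ← zpow_natCast q 9, ← zpow_neg, ← zpow_mul, ← zpow_add₀ hq0,
      ← zpow_add₀ hq0]
    congr 1
    push_cast
    ring
  have h5 : q ^ (9 * n ^ 2 + (9 - 2 * k) * n + (3 - k)) =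
      q ^ (9 * n ^ 2) * q ^ (-(2 * k * n)) * q ^ (9 * n + (3 - k)) := by
    rw [← zpow_add₀ hq0, ← zpow_add₀ hq0]
    ring_nf
  have h6 : q ^ (9 * n + (3 - k)) ≠ 0 := zpow_ne_zero _ hq0
  rw [Equiv.neg_apply, lerchTerm, h1, h2, h3, h4, h5,
    ← mul_div_mul_right _ (1 + (q ^ (9 * n + (3 - k)))⁻¹) h6, add_mul, inv_mul_cancel₀ h6, one_mul,
    add_comm 1]
  ring

lemma evenTheta_cube (hx0 : x ≠ 0) :
    evenTheta (x ^ 3) x = poch x (x ^ 6) * poch (x ^ 5) (x ^ 6) := by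
  have e : (x ^ 3) ^ 2 / (x ^ 2 * x ^ 3) = x := by field_simp
  rw [evenTheta, modTheta, e, mul_comm, ← pow_add, ← pow_mul]

lemma evenTheta_cube_one (hx0 : x ≠ 0) :
    evenTheta (x ^ 3) 1 = poch (x ^ 3) (x ^ 6) ^ 2 := by
  have e : (x ^ 3) ^ 2 / x ^ 3 = x ^ 3 := by field_simp
  rw [evenTheta, modTheta, one_pow, one_mul, e, ← pow_mul, sq]

lemma modTheta_cube (hx0 : x ≠ 0) :
    modTheta x (x ^ 3) = poch x (x ^ 3) * poch (x ^ 2) (x ^ 3) := by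
  have e : x ^ 3 / x = x ^ 2 := by field_simp
  rw [modTheta, e]

lemma modTheta_cube_neg (hx0 : x ≠ 0) :
    modTheta (-x) (x ^ 3) = poch (-x) (x ^ 3) * poch (-x ^ 2) (x ^ 3) := by
  have e : x ^ 3 / -x = -x ^ 2 := by field_simp
  rw [modTheta, e]

lemma modTheta_sq_cube (hx0 : x ≠ 0) : modTheta (x ^ 2) (x ^ 3) = modTheta x (x ^ 3) := by
  have e : x ^ 3 / x = x ^ 2 := by field_simp
  rw [← e, modTheta_div (pow_ne_zero 3 hx0)]

lemma modTheta_neg_sq_cube (hx0 : x ≠ 0) :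
    modTheta (-x ^ 2) (x ^ 3) = modTheta (-x) (x ^ 3) := by
  have e : x ^ 3 / -x = -x ^ 2 := by field_simp
  rw [← e, modTheta_div (pow_ne_zero 3 hx0)]

lemma modTheta_neg_one (hq : ‖q‖ < 1) : modTheta (-1) q = 2 * poch (-q) q ^ 2 := by
  rw [modTheta, poch_eq_mul (-1) hq, div_neg, div_one, neg_one_mul]
  ring

lemma mul_zpow_cube_ne_one (hx0 : 0 < ‖x‖) (hx : ‖x‖ < 1) {ε : ℂ} (hε : ‖ε‖ = 1) {k : ℤ}
    (hk : k % 3 ≠ 0) (n : ℤ) : ε * x ^ k ≠ (x ^ 3) ^ n := by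
  intro h
  have h1 := congrArg norm h
  rw [norm_mul, hε, one_mul, norm_zpow, norm_zpow, norm_pow, ← zpow_natCast, ← zpow_mul] at h1
  have := zpow_right_injective₀ hx0 hx.ne h1
  push_cast at this
  omega

/-- The specialization of `lerchRemainder_eq` to base `x ^ 3`. -/
lemma lerchEven_cube (hx0 : 0 < ‖x‖) (hx : ‖x‖ < 1) :
    lerchEven x (x ^ 3) x = evenTheta (x ^ 3) x / evenTheta (x ^ 3) 1 * lerchEven x (x ^ 3) 1 +
      poch (x ^ 3) (x ^ 3) ^ 2 * modTheta x (x ^ 3) ^ 3 /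
        (2 * poch (-x ^ 3) (x ^ 3) ^ 2 * modTheta (-x) (x ^ 3) ^ 3) := by
  have hx0' : x ≠ 0 := norm_pos_iff.1 hx0
  have hP0 : x ^ 3 ≠ 0 := pow_ne_zero 3 hx0'
  have hP : ‖x ^ 3‖ < 1 := norm_pow_lt_one_of three_ne_zero hx
  have hE : evenTheta (x ^ 3) x ≠ 0 := by
    refine evenTheta_ne_zero hP0 hP hx0' fun n hn ↦ ?_
    refine mul_zpow_cube_ne_one hx0 hx norm_one (k := 5) (by norm_num) (2 * n) ?_
    rw [one_mul, zpow_mul, ← pow_add] at *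
    exact_mod_cast hn
  have key := lerchRemainder_eq (norm_pos_iff.2 hP0) hP hx0' fun n hn ↦
    mul_zpow_cube_ne_one (x := (‖x‖ : ℂ)) (by simpa) (by simpa) norm_one (k := 2) (by norm_num) n
      (by rw [norm_pow] at hn; rw [one_mul]; exact_mod_cast hn)
  have hpole : poleTheta x (x ^ 3) x = 2 * poch (-x ^ 3) (x ^ 3) ^ 2 * modTheta (-x) (x ^ 3) := by
    rw [poleTheta, inv_mul_cancel₀ hx0', modTheta_neg_one hP, ← sq, modTheta_neg_sq_cube hx0']
  rw [lerchRemainder, lerchRemainder, modTheta_one hP, hpole, residueConst,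
    modTheta_sq_cube hx0'] at key
  have h2 : lerchEven x (x ^ 3) x = evenTheta (x ^ 3) x *
      (lerchEven x (x ^ 3) x / evenTheta (x ^ 3) x) := by field_simp
  rw [h2, eq_add_of_sub_eq key]
  field_simp
  ring

lemma poch_cube_mul (hx : ‖x‖ < 1) :
    poch (x ^ 3) (x ^ 6) * poch (-x ^ 3) (x ^ 3) = 1 := by
  have hP : ‖x ^ 3‖ < 1 := norm_pow_lt_one_of three_ne_zero hx
  have h1 := poch_eq_prod_residues (x ^ 3) hP two_ne_zero
  have h2 := poch_mul_poch_neg (x ^ 3) hP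
  simp only [Finset.prod_range_succ, Finset.prod_range_zero, one_mul, mul_one,
    ← pow_add, ← pow_mul] at h1 h2
  norm_num at h1 h2
  refine mul_left_cancel₀ (poch_self_ne_zero hP) ?_
  linear_combination (poch (x ^ 3) (x ^ 6)) * h2 - h1

lemma poch_mul_cube_neg (hx : ‖x‖ < 1) :
    poch x (x ^ 6) * poch (x ^ 5) (x ^ 6) * (poch (-x) (x ^ 3) * poch (-x ^ 2) (x ^ 3)) *
      (poch x (x ^ 3) * poch (x ^ 2) (x ^ 3)) = poch x (x ^ 3) * poch (x ^ 2) (x ^ 3) := by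
  have hP : ‖x ^ 3‖ < 1 := norm_pow_lt_one_of three_ne_zero hx
  have h1 := poch_eq_prod_residues x hP two_ne_zero
  have h2 := poch_eq_prod_residues (x ^ 2) hP two_ne_zero
  have h3 := poch_mul_poch_neg x hP
  have h4 := poch_mul_poch_neg (x ^ 2) hP
  simp only [Finset.prod_range_succ, Finset.prod_range_zero, one_mul, mul_one,
    ← pow_succ', ← pow_add, ← pow_mul] at h1 h2 h3 h4
  norm_num at h1 h2 h3 h4
  calc _ = poch x (x ^ 6) * poch (x ^ 5) (x ^ 6) * (poch x (x ^ 3) * poch (-x) (x ^ 3)) *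
        (poch (x ^ 2) (x ^ 3) * poch (-x ^ 2) (x ^ 3)) := by ring
    _ = _ := by rw [h3, h4, h1, h2]; ring

lemma poch_sq_sq (hx : ‖x‖ < 1) :
    poch (x ^ 2) (x ^ 2) = poch x (x ^ 3) * poch (x ^ 2) (x ^ 3) *
      (poch (-x) (x ^ 3) * poch (-x ^ 2) (x ^ 3)) * poch (x ^ 6) (x ^ 6) := by
  have hP : ‖x ^ 3‖ < 1 := norm_pow_lt_one_of three_ne_zero hx
  have h1 := poch_eq_prod_residues (x ^ 2) (norm_pow_lt_one_of two_ne_zero hx) three_ne_zero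
  have h3 := poch_mul_poch_neg x hP
  have h4 := poch_mul_poch_neg (x ^ 2) hP
  simp only [Finset.prod_range_succ, Finset.prod_range_zero, one_mul, mul_one,
    ← pow_add, ← pow_mul] at h1 h3 h4
  norm_num at h1 h3 h4
  rw [h1, ← h3, ← h4]
  ring

lemma cube_eta_quotient (hx0 : 0 < ‖x‖) (hx : ‖x‖ < 1) :
    poch (x ^ 3) (x ^ 3) ^ 2 * modTheta x (x ^ 3) ^ 3 /
        (2 * poch (-x ^ 3) (x ^ 3) ^ 2 * modTheta (-x) (x ^ 3) ^ 3) =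
      (poch x (x ^ 6) * poch (x ^ 5) (x ^ 6) * poch (x ^ 6) (x ^ 6)) ^ 6 *
        poch (x ^ 2) (x ^ 2) ^ 3 *
        (poch (x ^ 3) (x ^ 6) * poch (x ^ 3) (x ^ 6) * poch (x ^ 6) (x ^ 6)) ^ 2 /
        (2 * poch (x ^ 6) (x ^ 6) ^ 9) := by
  have hx0' : x ≠ 0 := norm_pos_iff.1 hx0
  have hP0 : x ^ 3 ≠ 0 := pow_ne_zero 3 hx0'
  have hP : ‖x ^ 3‖ < 1 := norm_pow_lt_one_of three_ne_zero hx
  have hA : modTheta x (x ^ 3) ≠ 0 := modTheta_ne_zero hP0 hP hx0' fun n hn ↦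
    mul_zpow_cube_ne_one hx0 hx norm_one (k := 1) (by norm_num) n (by simpa using hn)
  have hB : modTheta (-x) (x ^ 3) ≠ 0 := modTheta_ne_zero hP0 hP (neg_ne_zero.2 hx0') fun n hn ↦
    mul_zpow_cube_ne_one hx0 hx (ε := -1) (by simp) (k := 1) (by norm_num) n (by simpa using hn)
  have h1 := poch_cube_mul hx
  have h2 := poch_mul_cube_neg hx
  have h3 := poch_sq_sq hx
  have h4 := poch_mul_poch_neg (x ^ 3) hP
  rw [← modTheta_cube hx0', ← modTheta_cube_neg hx0'] at h2 h3
  rw [← pow_mul] at h4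
  norm_num at h4
  have h5 := eq_div_of_mul_eq hB (mul_right_cancel₀ hA (h2.trans (one_mul _).symm))
  have hp' : poch (-x ^ 3) (x ^ 3) ≠ 0 := right_ne_zero_of_mul (h1.trans_ne one_ne_zero)
  have hp := poch_self_ne_zero hP
  rw [h3, h5, eq_div_of_mul_eq hp' h1, ← h4]
  field_simp

end CubicBase

theorem stmt14 (q : ℂ) (hq0 : 0 < ‖q‖) (hq : ‖q‖ < 1)
    (hden : ∀ m : ℤ, q ^ m ≠ -1) :
    (∑' n : ℤ, (-1 : ℂ) ^ n * q ^ (9 * n ^ 2 + 3 * n) / (1 + q ^ (9 * n)))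
      + (∑' n : ℤ, (-1 : ℂ) ^ n * q ^ (9 * n ^ 2 + 15 * n + 6) / (1 + q ^ (9 * n + 6)))
      = 2 * Jam 3 18 q / Jam 9 18 q
          * (∑' n : ℤ, (-1 : ℂ) ^ n * q ^ (9 * n ^ 2 + 9 * n + 3) / (1 + q ^ (9 * n + 3)))
        + (Jam 3 18 q) ^ 6 * (Jm 6 q) ^ 3 * (Jam 9 18 q) ^ 2 / (2 * (Jm 18 q) ^ 9) := by
  have hq0' : q ≠ 0 := norm_pos_iff.1 hq0
  have hx0 : q ^ 3 ≠ 0 := pow_ne_zero 3 hq0'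
  have hx : ‖q ^ 3‖ < 1 := norm_pow_lt_one_of three_ne_zero hq
  have key := lerchEven_cube (norm_pos_iff.2 hx0) hx
  rw [cube_eta_quotient (norm_pos_iff.2 hx0) hx, evenTheta_cube hx0, evenTheta_cube_one hx0,
    lerchEven, lerchEven, inv_one] at key
  simp only [← pow_mul, Nat.reduceMul] at key
  have h1 := lerchSum_zpow hq0' 3
  have h2 := lerchSum_zpow hq0' (-3)
  have h3 := lerchSum_zpow hq0' 0
  rw [zpow_ofNat] at h1
  rw [zpow_neg, zpow_ofNat] at h2
  rw [zpow_zero] at h3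
  norm_num at h1 h2 h3
  have h6 : poch (q ^ 18) (q ^ 18) ≠ 0 :=
    poch_self_ne_zero (norm_pow_lt_one_of (by norm_num) hq)
  rw [← h1, ← h2, ← h3, key, Jm, Jm, Jam, Jam]
  simp only [Nat.reduceSub]
  congr 1
  rw [← mul_assoc 2, ← mul_two, ← sq, mul_div_mul_right _ _ h6]
  ring
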